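/- Let A = (a_{ij})_{i,j=1}^{2} be a 2×2 matrix of constant complex entries with a_{11} + a_{22} = 0. If a constant C ≥ 0 satisfies |∫_{ℝ²} Σ_{i,j=1}^{2} a_{ij} (∂u/∂x_i)(conj(∂u/∂x_j)) dx| ≤ C (∫_{ℝ²} |Δu| dx)² for all complex-valued u ∈ C_0^∞(ℝ²), then C ≥ (1/(4π)) · max_{ω ∈ S¹} |Σ_{i,j=1}^{2} a_{ij} ω_i ω_j|, where S¹ is the unit circle in ℝ². -/

import Mathlib

open MeasureTheory
open scoped Real

noncomputable section

/-- Euclidean plane. -/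
abbrev E2 := EuclideanSpace ℝ (Fin 2)

/-- Partial derivative of a complex-valued function on `ℝ²` in the `i`-th coordinate
direction. -/
def pd (i : Fin 2) (u : E2 → ℂ) (x : E2) : ℂ :=
  fderiv ℝ u x (EuclideanSpace.single i 1)

/-- The Laplacian of a complex-valued function on `ℝ²`. -/
def lap (u : E2 → ℂ) (x : E2) : ℂ :=
  pd 0 (pd 0 u) x + pd 1 (pd 1 u) x

/-! ### Partial derivatives of real functions on the plane -/

/-- Partial derivative of a real-valued function on the plane. -/
def rpd (i : Fin 2) (u : E2 → ℝ) (x : E2) : ℝ :=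
  fderiv ℝ u x (EuclideanSpace.single i 1)

/-- The Laplacian of a real-valued function on the plane. -/
def rlap (u : E2 → ℝ) (x : E2) : ℝ :=
  rpd 0 (rpd 0 u) x + rpd 1 (rpd 1 u) x

/-- The trace-free symmetric bilinear form with matrix `[[α, β], [β, -α]]`. -/
def tform (α β : ℝ) (x y : E2) : ℝ :=
  α * (x 0 * y 0 - x 1 * y 1) + β * (x 0 * y 1 + x 1 * y 0)

/-- The gradient, as a vector of the Euclidean plane. -/
def grad (u : E2 → ℝ) (x : E2) : E2 := !₂[rpd 0 u x, rpd 1 u x]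

@[simp] lemma grad_apply_zero (u : E2 → ℝ) (x : E2) : grad u x 0 = rpd 0 u x := rfl

@[simp] lemma grad_apply_one (u : E2 → ℝ) (x : E2) : grad u x 1 = rpd 1 u x := rfl

lemma contDiff_rpd {u : E2 → ℝ} (hu : ContDiff ℝ (⊤ : ℕ∞) u) (i : Fin 2) :
    ContDiff ℝ (⊤ : ℕ∞) (rpd i u) :=
  (hu.fderiv_right (m := (⊤ : ℕ∞)) (by simp)).clm_apply contDiff_const

lemma hasCompactSupport_rpd {u : E2 → ℝ} (hu : HasCompactSupport u) (i : Fin 2) :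
    HasCompactSupport (rpd i u) :=
  hu.fderiv_apply ℝ _

lemma contDiff_rlap {u : E2 → ℝ} (hu : ContDiff ℝ (⊤ : ℕ∞) u) :
    ContDiff ℝ (⊤ : ℕ∞) (rlap u) :=
  (contDiff_rpd (contDiff_rpd hu 0) 0).add (contDiff_rpd (contDiff_rpd hu 1) 1)

lemma hasCompactSupport_rlap {u : E2 → ℝ} (hu : HasCompactSupport u) :
    HasCompactSupport (rlap u) :=
  (hasCompactSupport_rpd (hasCompactSupport_rpd hu 0) 0).add
    (hasCompactSupport_rpd (hasCompactSupport_rpd hu 1) 1)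

lemma rpd_comm {u : E2 → ℝ} (hu : ContDiff ℝ (⊤ : ℕ∞) u) (i j : Fin 2) (x : E2) :
    rpd i (rpd j u) x = rpd j (rpd i u) x := by
  have hd : DifferentiableAt ℝ (fderiv ℝ u) x :=
    ((hu.fderiv_right (m := (⊤ : ℕ∞)) (by simp)).differentiable (by simp)) x
  have key : ∀ k l : Fin 2, rpd k (rpd l u) x =
      fderiv ℝ (fderiv ℝ u) x (EuclideanSpace.single k 1) (EuclideanSpace.single l 1) := by
    intro k l
    have : HasFDerivAt (rpd l u) _ x := hd.hasFDerivAt.clm_apply (hasFDerivAt_const _ x)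
    simp [rpd, this.fderiv]
  rw [key, key]
  exact (hu.contDiffAt.isSymmSndFDerivAt
    (by simpa using WithTop.coe_le_coe.2 (le_top : (2 : ℕ∞) ≤ ⊤))) _ _

lemma rpd_add {f g : E2 → ℝ} {x : E2} (i : Fin 2) (hf : DifferentiableAt ℝ f x)
    (hg : DifferentiableAt ℝ g x) :
    rpd i (fun y => f y + g y) x = rpd i f x + rpd i g x := by
  simp [rpd, fderiv_fun_add hf hg]

lemma rpd_sub {f g : E2 → ℝ} {x : E2} (i : Fin 2) (hf : DifferentiableAt ℝ f x)
    (hg : DifferentiableAt ℝ g x) :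
    rpd i (fun y => f y - g y) x = rpd i f x - rpd i g x := by
  simp [rpd, fderiv_fun_sub hf hg]

lemma rpd_mul {f g : E2 → ℝ} {x : E2} (i : Fin 2) (hf : DifferentiableAt ℝ f x)
    (hg : DifferentiableAt ℝ g x) :
    rpd i (fun y => f y * g y) x = rpd i f x * g x + f x * rpd i g x := by
  simp [rpd, fderiv_fun_mul hf hg]; ring

lemma rpd_const (i : Fin 2) (c : ℝ) (x : E2) : rpd i (fun _ => c) x = 0 := by
  simp [rpd]

lemma rpd_coord (i j : Fin 2) (x : E2) :
    rpd i (fun y : E2 => y j) x = if j = i then 1 else 0 := by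
  have : HasFDerivAt (fun y : E2 => y j) (EuclideanSpace.proj j : E2 →L[ℝ] ℝ) x :=
    (EuclideanSpace.proj j : E2 →L[ℝ] ℝ).hasFDerivAt
  simp [rpd, this.fderiv]

lemma rpd_sum {ι : Type*} (s : Finset ι) {f : ι → E2 → ℝ} {x : E2} (i : Fin 2)
    (hf : ∀ k ∈ s, DifferentiableAt ℝ (f k) x) :
    rpd i (fun y => ∑ k ∈ s, f k y) x = ∑ k ∈ s, rpd i (f k) x := by
  simp [rpd, fderiv_fun_sum hf]

lemma rpd_comp_sub (i : Fin 2) (u : E2 → ℝ) (p x : E2) :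
    rpd i (fun y => u (y - p)) x = rpd i u (x - p) := by
  simp only [rpd, fderiv_comp_sub]

lemma rlap_comp_sub (u : E2 → ℝ) (p x : E2) :
    rlap (fun y => u (y - p)) x = rlap u (x - p) := by
  have h : ∀ i, rpd i (fun y => u (y - p)) = fun y => rpd i u (y - p) :=
    fun i => funext (rpd_comp_sub i u p)
  simp only [rlap, h, rpd_comp_sub]

lemma integral_rpd_eq_zero {u : E2 → ℝ} (hu : ContDiff ℝ (⊤ : ℕ∞) u)
    (hs : HasCompactSupport u) (i : Fin 2) : ∫ x, rpd i u x = 0 := by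
  have hi : Integrable u := hu.continuous.integrable_of_hasCompactSupport hs
  have hi' : Integrable (rpd i u) :=
    (contDiff_rpd hu i).continuous.integrable_of_hasCompactSupport (hasCompactSupport_rpd hs i)
  have := integral_mul_fderiv_eq_neg_fderiv_mul_of_integrable (μ := (volume : Measure E2))
    (f := fun _ => (1 : ℝ)) (g := u) (v := EuclideanSpace.single i 1)
    (by simp) (by simp only [one_mul]; exact hi') (by simpa using hi) (by simp)
    (fun x _ => hu.differentiable (by simp) x)
  simpa [rpd] using this

lemma contDiff_coord (j : Fin 2) : ContDiff ℝ (⊤ : ℕ∞) (fun y : E2 => y j) :=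
  (EuclideanSpace.proj j : E2 →L[ℝ] ℝ).contDiff

/-- Rellich's identity for the linear vector field given by the trace-free matrix. -/
lemma integral_tform_grad {w v : E2 → ℝ} (hw : ContDiff ℝ (⊤ : ℕ∞) w)
    (hws : HasCompactSupport w) (hv : ContDiff ℝ (⊤ : ℕ∞) v) (hvs : HasCompactSupport v)
    (α β : ℝ) :
    2 * ∫ x, tform α β (grad w x) (grad v x) =
      -((∫ x, tform α β x (grad w x) * rlap v x) +
        ∫ x, tform α β x (grad v x) * rlap w x) := by
  have hw0 := contDiff_rpd hw 0
  have hw1 := contDiff_rpd hw 1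
  have hv0 := contDiff_rpd hv 0
  have hv1 := contDiff_rpd hv 1
  have hc0 := contDiff_coord 0
  have hc1 := contDiff_coord 1
  have hlw := contDiff_rlap hw
  have hlv := contDiff_rlap hv
  have hw0s := hasCompactSupport_rpd hws 0
  have hw1s := hasCompactSupport_rpd hws 1
  obtain ⟨X0, hX0⟩ : ∃ X0 : E2 → ℝ, X0 = fun x => α * x 0 + β * x 1 := ⟨_, rfl⟩
  obtain ⟨X1, hX1⟩ : ∃ X1 : E2 → ℝ, X1 = fun x => β * x 0 - α * x 1 := ⟨_, rfl⟩
  have hX0c : ContDiff ℝ (⊤ : ℕ∞) X0 := by rw [hX0]; fun_prop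
  have hX1c : ContDiff ℝ (⊤ : ℕ∞) X1 := by rw [hX1]; fun_prop
  have hX00 : ∀ x, rpd 0 X0 x = α := fun x => by
    rw [hX0, rpd_add, rpd_mul, rpd_mul, rpd_const, rpd_const, rpd_coord, rpd_coord] <;>
      first | fun_prop | simp
  have hX11 : ∀ x, rpd 1 X1 x = -α := fun x => by
    rw [hX1, rpd_sub, rpd_mul, rpd_mul, rpd_const, rpd_const, rpd_coord, rpd_coord] <;>
      first | fun_prop | simp
  have hX01 : ∀ x, rpd 1 X0 x = β := fun x => by
    rw [hX0, rpd_add, rpd_mul, rpd_mul, rpd_const, rpd_const, rpd_coord, rpd_coord] <;>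
      first | fun_prop | simp
  have hX10 : ∀ x, rpd 0 X1 x = β := fun x => by
    rw [hX1, rpd_sub, rpd_mul, rpd_mul, rpd_const, rpd_const, rpd_coord, rpd_coord] <;>
      first | fun_prop | simp
  set V0 : E2 → ℝ := fun x => X0 x * (rpd 0 w x * rpd 0 v x - rpd 1 w x * rpd 1 v x) +
    X1 x * (rpd 1 w x * rpd 0 v x + rpd 0 w x * rpd 1 v x) with hV0
  set V1 : E2 → ℝ := fun x => X0 x * (rpd 0 w x * rpd 1 v x + rpd 1 w x * rpd 0 v x) +
    X1 x * (rpd 1 w x * rpd 1 v x - rpd 0 w x * rpd 0 v x) with hV1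
  have hV0c : ContDiff ℝ (⊤ : ℕ∞) V0 := by fun_prop
  have hV1c : ContDiff ℝ (⊤ : ℕ∞) V1 := by fun_prop
  have hV0s : HasCompactSupport V0 :=
    ((hw0s.mul_right.sub hw1s.mul_right).mul_left).add
      ((hw1s.mul_right.add hw0s.mul_right).mul_left)
  have hV1s : HasCompactSupport V1 :=
    ((hw0s.mul_right.add hw1s.mul_right).mul_left).add
      ((hw1s.mul_right.sub hw0s.mul_right).mul_left)
  have d {f : E2 → ℝ} (hf : ContDiff ℝ (⊤ : ℕ∞) f) : Differentiable ℝ f :=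
    hf.differentiable (by simp)
  have dX0 := d hX0c
  have dX1 := d hX1c
  have dw0 := d hw0
  have dw1 := d hw1
  have dv0 := d hv0
  have dv1 := d hv1
  have hdiv : ∀ x, rpd 0 V0 x + rpd 1 V1 x = tform α β x (grad w x) * rlap v x +
      tform α β x (grad v x) * rlap w x + 2 * tform α β (grad w x) (grad v x) := by
    intro x
    have e0 : rpd 0 V0 x = rpd 0 X0 x * (rpd 0 w x * rpd 0 v x - rpd 1 w x * rpd 1 v x) +
        X0 x * (rpd 0 (rpd 0 w) x * rpd 0 v x + rpd 0 w x * rpd 0 (rpd 0 v) x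
          - (rpd 0 (rpd 1 w) x * rpd 1 v x + rpd 1 w x * rpd 0 (rpd 1 v) x)) +
        (rpd 0 X1 x * (rpd 1 w x * rpd 0 v x + rpd 0 w x * rpd 1 v x) +
        X1 x * (rpd 0 (rpd 1 w) x * rpd 0 v x + rpd 1 w x * rpd 0 (rpd 0 v) x
          + (rpd 0 (rpd 0 w) x * rpd 1 v x + rpd 0 w x * rpd 0 (rpd 1 v) x))) := by
      simp (disch := fun_prop) only [hV0, rpd_add, rpd_mul, rpd_sub]
    have e1 : rpd 1 V1 x = rpd 1 X0 x * (rpd 0 w x * rpd 1 v x + rpd 1 w x * rpd 0 v x) +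
        X0 x * (rpd 1 (rpd 0 w) x * rpd 1 v x + rpd 0 w x * rpd 1 (rpd 1 v) x
          + (rpd 1 (rpd 1 w) x * rpd 0 v x + rpd 1 w x * rpd 1 (rpd 0 v) x)) +
        (rpd 1 X1 x * (rpd 1 w x * rpd 1 v x - rpd 0 w x * rpd 0 v x) +
        X1 x * (rpd 1 (rpd 1 w) x * rpd 1 v x + rpd 1 w x * rpd 1 (rpd 1 v) x
          - (rpd 1 (rpd 0 w) x * rpd 0 v x + rpd 0 w x * rpd 1 (rpd 0 v) x))) := by
      simp (disch := fun_prop) only [hV1, rpd_add, rpd_mul, rpd_sub]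
    rw [e0, e1, hX00, hX01, hX10, hX11, rpd_comm hw 1 0, rpd_comm hv 1 0]
    simp only [tform, rlap, grad_apply_zero, grad_apply_one, hX0, hX1]
    ring
  have hint {f : E2 → ℝ} (hf : ContDiff ℝ (⊤ : ℕ∞) f) (hs : HasCompactSupport f) :
      Integrable f := hf.continuous.integrable_of_hasCompactSupport hs
  have i1 : Integrable fun x => tform α β x (grad w x) * rlap v x := by
    refine hint ?_ (hasCompactSupport_rlap hvs).mul_left
    simp only [tform, grad_apply_zero, grad_apply_one]
    fun_prop
  have i2 : Integrable fun x => tform α β x (grad v x) * rlap w x := by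
    refine hint ?_ (hasCompactSupport_rlap hws).mul_left
    simp only [tform, grad_apply_zero, grad_apply_one]
    fun_prop
  have i3 : Integrable fun x => 2 * tform α β (grad w x) (grad v x) := by
    refine hint ?_ ?_
    · simp only [tform, grad_apply_zero, grad_apply_one]
      fun_prop
    · exact (((hw0s.mul_right.sub hw1s.mul_right).mul_left).add
        ((hw0s.mul_right.add hw1s.mul_right).mul_left)).mul_left
  have hz : ∫ x, (rpd 0 V0 x + rpd 1 V1 x) = 0 := by
    rw [integral_add (hint (contDiff_rpd hV0c 0) (hasCompactSupport_rpd hV0s 0))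
      (hint (contDiff_rpd hV1c 1) (hasCompactSupport_rpd hV1s 1)),
      integral_rpd_eq_zero hV0c hV0s, integral_rpd_eq_zero hV1c hV1s, add_zero]
  simp only [hdiv] at hz
  rw [integral_add (by exact i1.add i2) i3, integral_add i1 i2, integral_const_mul] at hz
  linarith

/-! ### Radial functions -/

lemma norm_sq_eq_coord (x : E2) : ‖x‖ ^ 2 = x 0 ^ 2 + x 1 ^ 2 := by
  simp [EuclideanSpace.norm_sq_eq]

lemma rpd_radial {g : ℝ → ℝ} {g' : ℝ} {x : E2} (hg : HasDerivAt g g' (‖x‖ ^ 2)) (i : Fin 2) :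
    rpd i (fun y => g (‖y‖ ^ 2)) x = 2 * x i * g' := by
  have h1 : HasFDerivAt (fun y : E2 => ‖y‖ ^ 2) (2 • innerSL ℝ x) x :=
    (hasStrictFDerivAt_norm_sq x).hasFDerivAt
  have : HasFDerivAt (fun y : E2 => g (‖y‖ ^ 2)) _ x := hg.comp_hasFDerivAt x h1
  simp [rpd, this.fderiv, EuclideanSpace.inner_single_right]
  ring

/-- A smooth step, equal to `0` on `(-∞, 1/2]` and to `1` on `[1, ∞)`. -/
def step (t : ℝ) : ℝ := Real.smoothTransition (2 * t - 1)

lemma step_of_le {t : ℝ} (h : t ≤ 1 / 2) : step t = 0 :=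
  Real.smoothTransition.zero_of_nonpos (by linarith)

lemma step_of_one_le {t : ℝ} (h : 1 ≤ t) : step t = 1 :=
  Real.smoothTransition.one_of_one_le (by linarith)

lemma step_nonneg (t : ℝ) : 0 ≤ step t := Real.smoothTransition.nonneg _

lemma step_le_one (t : ℝ) : step t ≤ 1 := Real.smoothTransition.le_one _

lemma contDiff_step : ContDiff ℝ (⊤ : ℕ∞) step :=
  Real.smoothTransition.contDiff.comp ((contDiff_const.mul contDiff_id).sub contDiff_const)

lemma monotone_step : Monotone step :=
  fun _ _ h => Real.smoothTransition.monotone (by linarith)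

/-- The quotient `step t / t`. -/
def stepDiv (t : ℝ) : ℝ := step t / t

lemma stepDiv_of_le {t : ℝ} (h : t ≤ 1 / 2) : stepDiv t = 0 := by
  simp [stepDiv, step_of_le h]

lemma stepDiv_of_one_le {t : ℝ} (h : 1 ≤ t) : stepDiv t = 1 / t := by
  simp [stepDiv, step_of_one_le h]

lemma stepDiv_mul_self (t : ℝ) : t * stepDiv t = step t := by
  rcases eq_or_ne t 0 with rfl | h
  · simp [step_of_le]
  · simp [stepDiv, mul_div_cancel₀ _ h]

lemma contDiff_stepDiv : ContDiff ℝ (⊤ : ℕ∞) stepDiv := by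
  rw [contDiff_iff_contDiffAt]
  intro t
  rcases eq_or_ne t 0 with rfl | h
  · refine (contDiffAt_const (c := (0 : ℝ))).congr_of_eventuallyEq ?_
    filter_upwards [Iio_mem_nhds (show (0 : ℝ) < 1 / 2 by norm_num)] with s hs
    exact stepDiv_of_le (le_of_lt hs)
  · exact contDiff_step.contDiffAt.div contDiffAt_id h

/-- A nonnegative radial bump of integral `2π`, supported in the unit disc. -/
def bump (x : E2) : ℝ := 2 * deriv step (‖x‖ ^ 2)

lemma continuous_deriv_step : Continuous (deriv step) :=
  contDiff_step.continuous_deriv (by simp)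

lemma continuous_bump : Continuous bump :=
  continuous_const.mul (continuous_deriv_step.comp (by fun_prop))

lemma bump_nonneg (x : E2) : 0 ≤ bump x :=
  mul_nonneg zero_le_two (monotone_step.deriv_nonneg)

lemma deriv_step_of_lt {t : ℝ} (h : t < 1 / 2) : deriv step t = 0 := by
  have : step =ᶠ[nhds t] fun _ => 0 := by
    filter_upwards [Iio_mem_nhds h] with s hs using step_of_le (le_of_lt hs)
  simp [this.deriv_eq]

lemma deriv_step_of_one_lt {t : ℝ} (h : 1 < t) : deriv step t = 0 := by
  have : step =ᶠ[nhds t] fun _ => 1 := by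
    filter_upwards [Ioi_mem_nhds h] with s hs using step_of_one_le (le_of_lt hs)
  simp [this.deriv_eq]

lemma bump_of_norm_lt {x : E2} (h : ‖x‖ < 1 / 2) : bump x = 0 := by
  rw [bump, deriv_step_of_lt (by nlinarith [norm_nonneg x]), mul_zero]

lemma bump_of_one_lt_norm {x : E2} (h : 1 < ‖x‖) : bump x = 0 := by
  rw [bump, deriv_step_of_one_lt (by nlinarith [norm_nonneg x]), mul_zero]

lemma bump_neg (x : E2) : bump (-x) = bump x := by simp [bump]

lemma hasCompactSupport_bump : HasCompactSupport bump :=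
  HasCompactSupport.intro (isCompact_closedBall (0 : E2) 1) fun x hx =>
    bump_of_one_lt_norm (by simpa using hx)

lemma integrable_bump : Integrable bump :=
  continuous_bump.integrable_of_hasCompactSupport hasCompactSupport_bump

lemma integral_bump : ∫ x, bump x = 2 * π := by
  have h := integral_fun_norm_addHaar (volume : Measure E2) (fun r => 2 * deriv step (r ^ 2))
  have hd : ∀ r ∈ Set.Ioi (0 : ℝ), HasDerivAt (fun r => step (r ^ 2))
      (r ^ (2 - 1) • (2 * deriv step (r ^ 2))) r := by
    intro r _
    have h1 : HasDerivAt step (deriv step (r ^ 2)) (r ^ 2) :=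
      (contDiff_step.differentiable (by simp) _).hasDerivAt
    have h2 := HasDerivAt.comp (h := fun r : ℝ => r ^ 2) r h1 (hasDerivAt_pow 2 r)
    convert! h2 using 1
    simp only [smul_eq_mul]
    push_cast
    ring
  have hint : ∫ r in Set.Ioi (0 : ℝ), r ^ (2 - 1) • (2 * deriv step (r ^ 2)) = 1 - 0 := by
    have h0 : (fun r : ℝ => step (r ^ 2)) 0 = 0 := step_of_le (by norm_num)
    refine Eq.trans ?_ (congrArg (1 - ·) h0)
    refine integral_Ioi_of_hasDerivAt_of_nonneg
      (Continuous.continuousWithinAt (contDiff_step.continuous.comp (continuous_pow 2))) hd ?_ ?_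
    · intro r hr
      exact mul_nonneg (by simpa using le_of_lt hr)
        (mul_nonneg zero_le_two monotone_step.deriv_nonneg)
    · refine tendsto_const_nhds.congr' ?_
      filter_upwards [Filter.eventually_ge_atTop (1 : ℝ)] with r hr
      exact (step_of_one_le (by nlinarith)).symm
  have hfin : Module.finrank ℝ E2 = 2 := by simp
  rw [hfin, hint] at h
  have hvol : (volume : Measure E2).real (Metric.ball 0 1) = π := by
    simp [Measure.real, EuclideanSpace.volume_ball_fin_two, Real.pi_pos.le]
  rw [hvol] at h
  simpa [bump] using h

/-- The radial profile of the gradient of `pot δ`. -/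
def prof (δ t : ℝ) : ℝ := (δ ^ 2)⁻¹ * stepDiv (t / δ ^ 2) - stepDiv t

lemma contDiff_prof (δ : ℝ) : ContDiff ℝ (⊤ : ℕ∞) (prof δ) :=
  (contDiff_const.mul (contDiff_stepDiv.comp (contDiff_id.div_const _))).sub contDiff_stepDiv

lemma prof_of_one_le {δ t : ℝ} (h0 : 0 < δ) (h1 : δ ≤ 1) (ht : 1 ≤ t) : prof δ t = 0 := by
  have hδ : δ ^ 2 ≤ 1 := pow_le_one₀ h0.le h1
  have : 1 ≤ t / δ ^ 2 := by
    rw [le_div_iff₀ (by positivity)]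
    linarith
  rw [prof, stepDiv_of_one_le this, stepDiv_of_one_le ht]
  field_simp
  ring

lemma prof_eq {δ t : ℝ} (h0 : 0 < δ) (ht : δ ^ 2 ≤ t) : prof δ t = (1 - step t) / t := by
  have : 1 ≤ t / δ ^ 2 := by
    rw [le_div_iff₀ (by positivity)]
    linarith
  have ht0 : 0 < t := lt_of_lt_of_le (by positivity) ht
  rw [prof, stepDiv_of_one_le this, stepDiv]
  field_simp

lemma abs_prof_le {δ t : ℝ} (h0 : 0 < δ) (ht : 0 < t) : |prof δ t| ≤ 1 / t := by
  have e : prof δ t = (step (t / δ ^ 2) - step t) / t := by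
    rw [prof, stepDiv, stepDiv]
    field_simp
  rw [e, abs_div, abs_of_pos ht]
  gcongr
  rw [abs_le]
  constructor <;> linarith [step_nonneg t, step_le_one t, step_nonneg (t / δ ^ 2),
    step_le_one (t / δ ^ 2)]

/-- A smooth radial function, supported in the unit disc, whose Laplacian is the difference of
the bump at scale `δ` and the bump at scale `1`. -/
def pot (δ : ℝ) (x : E2) : ℝ := (1 / 2) * ∫ s in (1 : ℝ)..‖x‖ ^ 2, prof δ s

lemma hasDerivAt_primitive_prof (δ t : ℝ) :
    HasDerivAt (fun t => (1 / 2) * ∫ s in (1 : ℝ)..t, prof δ s) ((1 / 2) * prof δ t) t :=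
  ((contDiff_prof δ).continuous.integral_hasStrictDerivAt 1 t).hasDerivAt.const_mul _

lemma contDiff_pot (δ : ℝ) : ContDiff ℝ (⊤ : ℕ∞) (pot δ) := by
  have h : ContDiff ℝ (⊤ : ℕ∞) (fun t => (1 / 2) * ∫ s in (1 : ℝ)..t, prof δ s) := by
    rw [contDiff_infty_iff_deriv]
    refine ⟨fun t => (hasDerivAt_primitive_prof δ t).differentiableAt, ?_⟩
    rw [show deriv _ = _ from funext fun t => (hasDerivAt_primitive_prof δ t).deriv]
    exact contDiff_const.mul (contDiff_prof δ)
  exact h.comp (contDiff_norm_sq ℝ)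

lemma hasCompactSupport_pot {δ : ℝ} (h0 : 0 < δ) (h1 : δ ≤ 1) : HasCompactSupport (pot δ) := by
  refine HasCompactSupport.intro (isCompact_closedBall (0 : E2) 1) fun x hx => ?_
  have hx : 1 < ‖x‖ := by simpa using hx
  have hx2 : (1 : ℝ) ≤ ‖x‖ ^ 2 := by nlinarith
  have : ∫ s in (1 : ℝ)..‖x‖ ^ 2, prof δ s = ∫ s in (1 : ℝ)..‖x‖ ^ 2, (0 : ℝ) := by
    refine intervalIntegral.integral_congr fun s hs => ?_
    rw [Set.uIcc_of_le hx2] at hs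
    exact prof_of_one_le h0 h1 hs.1
  simp [pot, this]

lemma rpd_pot (δ : ℝ) (i : Fin 2) (x : E2) : rpd i (pot δ) x = x i * prof δ (‖x‖ ^ 2) := by
  rw [show pot δ = fun y => (fun t => (1 / 2) * ∫ s in (1 : ℝ)..t, prof δ s) (‖y‖ ^ 2) from rfl,
    rpd_radial (hasDerivAt_primitive_prof δ _)]
  ring

lemma grad_pot (δ : ℝ) (x : E2) : grad (pot δ) x = prof δ (‖x‖ ^ 2) • x := by
  ext i
  fin_cases i <;> simp [rpd_pot, mul_comm]

lemma stepDiv_add_mul_deriv (t : ℝ) : stepDiv t + t * deriv stepDiv t = deriv step t := by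
  have h : HasDerivAt stepDiv (deriv stepDiv t) t :=
    (contDiff_stepDiv.differentiable (by simp) t).hasDerivAt
  have h2 := (hasDerivAt_id t).mul h
  have e : (id * stepDiv : ℝ → ℝ) = step := funext stepDiv_mul_self
  rw [e] at h2
  simpa using h2.deriv.symm

lemma rlap_pot {δ : ℝ} (h0 : 0 < δ) (x : E2) :
    rlap (pot δ) x = (δ ^ 2)⁻¹ * bump (δ⁻¹ • x) - bump x := by
  have hm : HasDerivAt (prof δ) ((δ ^ 2)⁻¹ * (deriv stepDiv (‖x‖ ^ 2 / δ ^ 2) * (1 / δ ^ 2)) -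
      deriv stepDiv (‖x‖ ^ 2)) (‖x‖ ^ 2) := by
    have h (t : ℝ) : HasDerivAt stepDiv (deriv stepDiv t) t :=
      (contDiff_stepDiv.differentiable (by simp) t).hasDerivAt
    exact (((h _).comp _ ((hasDerivAt_id _).div_const _)).const_mul _).sub (h _)
  have hd : DifferentiableAt ℝ (fun y : E2 => prof δ (‖y‖ ^ 2)) x :=
    (((contDiff_prof δ).comp (contDiff_norm_sq ℝ)).differentiable (by simp)) x
  have e (i : Fin 2) : rpd i (pot δ) = fun y => y i * prof δ (‖y‖ ^ 2) := funext (rpd_pot δ i)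
  have k (i : Fin 2) : rpd i (fun y : E2 => y i * prof δ (‖y‖ ^ 2)) x = prof δ (‖x‖ ^ 2) +
      x i * (2 * x i * ((δ ^ 2)⁻¹ * (deriv stepDiv (‖x‖ ^ 2 / δ ^ 2) * (1 / δ ^ 2)) -
      deriv stepDiv (‖x‖ ^ 2))) := by
    rw [rpd_mul i ((contDiff_coord i).differentiable (by simp) x) hd, rpd_coord, rpd_radial hm]
    simp
  have hn : ‖δ⁻¹ • x‖ ^ 2 = ‖x‖ ^ 2 / δ ^ 2 := by
    rw [norm_smul, mul_pow, norm_inv, Real.norm_of_nonneg h0.le]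
    field_simp
  simp only [rlap, e, k]
  simp only [bump, hn, ← stepDiv_add_mul_deriv, prof, norm_sq_eq_coord x]
  ring

/-! ### Interaction of two translated potentials -/

lemma abs_coord_le (x : E2) (i : Fin 2) : |x i| ≤ ‖x‖ := by
  simpa using PiLp.norm_apply_le x i

lemma abs_tform_le (α β : ℝ) (x y : E2) :
    |tform α β x y| ≤ 2 * (|α| + |β|) * (‖x‖ * ‖y‖) := by
  have h (i j : Fin 2) : |x i * y j| ≤ ‖x‖ * ‖y‖ := by
    rw [abs_mul]
    exact mul_le_mul (abs_coord_le x i) (abs_coord_le y j) (abs_nonneg _) (norm_nonneg _)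
  have h1 : |x 0 * y 0 - x 1 * y 1| ≤ 2 * (‖x‖ * ‖y‖) :=
    (abs_sub _ _).trans (by linarith [h 0 0, h 1 1])
  have h2 : |x 0 * y 1 + x 1 * y 0| ≤ 2 * (‖x‖ * ‖y‖) :=
    (abs_add_le _ _).trans (by linarith [h 0 1, h 1 0])
  calc |tform α β x y| ≤ |α| * |x 0 * y 0 - x 1 * y 1| + |β| * |x 0 * y 1 + x 1 * y 0| := by
        rw [tform, ← abs_mul, ← abs_mul]
        exact abs_add_le _ _
    _ ≤ |α| * (2 * (‖x‖ * ‖y‖)) + |β| * (2 * (‖x‖ * ‖y‖)) := by gcongr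
    _ = _ := by ring

lemma tform_smul_left (α β c : ℝ) (x y : E2) : tform α β (c • x) y = c * tform α β x y := by
  simp [tform]; ring

lemma tform_smul_right (α β c : ℝ) (x y : E2) : tform α β x (c • y) = c * tform α β x y := by
  simp [tform]; ring

lemma tform_add_left (α β : ℝ) (x y z : E2) :
    tform α β (x + y) z = tform α β x z + tform α β y z := by
  simp [tform]; ring

lemma tform_neg_neg (α β : ℝ) (x y : E2) : tform α β (-x) (-y) = tform α β x y := by
  simp [tform]

@[fun_prop]
lemma continuous_tform {X : Type*} [TopologicalSpace X] {f g : X → E2} (α β : ℝ)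
    (hf : Continuous f) (hg : Continuous g) : Continuous fun x => tform α β (f x) (g x) := by
  unfold tform
  fun_prop

/-- Rotation by a right angle. -/
def rot : E2 ≃ₗᵢ[ℝ] E2 where
  toFun x := !₂[-x 1, x 0]
  invFun x := !₂[x 1, -x 0]
  map_add' x y := by ext i; fin_cases i <;> simp; ring
  map_smul' c x := by ext i; fin_cases i <;> simp
  left_inv x := by ext i; fin_cases i <;> simp
  right_inv x := by ext i; fin_cases i <;> simp
  norm_map' x := by simp [EuclideanSpace.norm_eq, add_comm]

@[simp] lemma rot_apply_zero (x : E2) : rot x 0 = -x 1 := rfl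

@[simp] lemma rot_apply_one (x : E2) : rot x 1 = x 0 := rfl

lemma tform_rot_rot (α β : ℝ) (x y : E2) : tform α β (rot x) (rot y) = -tform α β x y := by
  simp [tform]; ring

lemma integral_radial_mul_tform (g : ℝ → ℝ) (α β : ℝ) :
    ∫ x : E2, g ‖x‖ * tform α β x x = 0 := by
  have h := rot.measurePreserving.integral_comp rot.toHomeomorph.measurableEmbedding
    (fun x => g ‖x‖ * tform α β x x)
  simp only [LinearIsometryEquiv.norm_map, tform_rot_rot, mul_neg, integral_neg] at h
  linarith

lemma grad_pot_neg (δ : ℝ) (x : E2) : grad (pot δ) (-x) = -grad (pot δ) x := by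
  simp [grad_pot]

lemma rlap_pot_neg {δ : ℝ} (h0 : 0 < δ) (x : E2) : rlap (pot δ) (-x) = rlap (pot δ) x := by
  simp [rlap_pot h0, bump_neg]

lemma grad_comp_sub (u : E2 → ℝ) (p x : E2) :
    grad (fun y => u (y - p)) x = grad u (x - p) := by
  simp [grad, rpd_comp_sub]

lemma continuous_grad_pot (δ : ℝ) : Continuous (grad (pot δ)) := by
  rw [show grad (pot δ) = _ from funext (grad_pot δ)]
  have := (contDiff_prof δ).continuous
  fun_prop

/-- The interaction integral of two potentials whose centres differ by `d`. -/
def inter (α β δ : ℝ) (d : E2) : ℝ :=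
  ∫ x, rlap (pot δ) x * (tform α β ((2 : ℝ) • x + d) (x + d) * prof δ (‖x + d‖ ^ 2))

lemma integral_tform_grad_pot (α β : ℝ) {δ : ℝ} (h0 : 0 < δ) (h1 : δ ≤ 1) (p q : E2) :
    2 * ∫ x, tform α β (grad (pot δ) (x - p)) (grad (pot δ) (x - q)) =
      -inter α β δ (q - p) := by
  have hc (p : E2) : ContDiff ℝ (⊤ : ℕ∞) fun y => pot δ (y - p) :=
    (contDiff_pot δ).comp (contDiff_id.sub contDiff_const)
  have hs (p : E2) : HasCompactSupport fun y => pot δ (y - p) :=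
    (hasCompactSupport_pot h0 h1).comp_homeomorph (Homeomorph.subRight p)
  have h := integral_tform_grad (hc p) (hs p) (hc q) (hs q) α β
  simp only [grad_comp_sub, rlap_comp_sub] at h
  rw [h]
  have cl := (contDiff_rlap (contDiff_pot δ)).continuous
  have sl := hasCompactSupport_rlap (hasCompactSupport_pot h0 h1)
  have cg := continuous_grad_pot δ
  have e1 : ∫ x, tform α β x (grad (pot δ) (x - p)) * rlap (pot δ) (x - q) =
      ∫ x, tform α β (x + q) (grad (pot δ) (x + q - p)) * rlap (pot δ) x := by
    rw [← integral_add_right_eq_self _ q]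
    simp
  have e2 : ∫ x, tform α β x (grad (pot δ) (x - q)) * rlap (pot δ) (x - p) =
      ∫ x, tform α β (x - p) (grad (pot δ) (x + q - p)) * rlap (pot δ) x := by
    rw [← integral_sub_left_eq_self _ volume p]
    refine integral_congr_ae (.of_forall fun x => ?_)
    simp only
    rw [show p - x - q = -(x + q - p) by abel, show p - x - p = -x by abel,
      show p - x = -(x - p) by abel, grad_pot_neg, tform_neg_neg, rlap_pot_neg h0]
  rw [e1, e2, inter, ← integral_add]
  · congr 1
    refine integral_congr_ae (.of_forall fun x => ?_)
    simp only
    rw [← add_mul, ← tform_add_left, grad_pot, tform_smul_right,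
      show x + q + (x - p) = (2 : ℝ) • x + (q - p) by rw [two_smul]; abel,
      show x + q - p = x + (q - p) by abel]
    ring
  · exact Continuous.integrable_of_hasCompactSupport (by fun_prop) sl.mul_left
  · exact Continuous.integrable_of_hasCompactSupport (by fun_prop) sl.mul_left

lemma inter_zero (α β : ℝ) {δ : ℝ} (h0 : 0 < δ) : inter α β δ 0 = 0 := by
  rw [← integral_radial_mul_tform (fun r => 2 * prof δ (r ^ 2) *
    ((δ ^ 2)⁻¹ * (2 * deriv step ((δ⁻¹ * r) ^ 2)) - 2 * deriv step (r ^ 2))) α β]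
  refine integral_congr_ae (.of_forall fun x => ?_)
  simp only [add_zero, rlap_pot h0, tform_smul_left, bump, norm_smul, norm_inv,
    Real.norm_of_nonneg h0.le]
  ring

/-- The kernel, homogeneous of degree zero, of the interaction between distant point charges. -/
def kernelForm (α β : ℝ) (p : E2) : ℝ := tform α β p p / ‖p‖ ^ 2

lemma inter_eq (α β : ℝ) {η : ℝ} (h0 : 0 < η) (p : E2) :
    inter α β (η ^ 2) (η • p) =
      (∫ y, bump y * (tform α β ((2 * η) • y + p) (η • y + p) *
        (η ^ 2 * prof (η ^ 2) (η ^ 2 * ‖η • y + p‖ ^ 2)))) -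
      ∫ x, bump x * (tform α β ((2 : ℝ) • x + η • p) (x + η • p) *
        prof (η ^ 2) (‖x + η • p‖ ^ 2)) := by
  set Φ : E2 → ℝ := fun x => tform α β ((2 : ℝ) • x + η • p) (x + η • p) *
        prof (η ^ 2) (‖x + η • p‖ ^ 2) with hΦ
  have hη : 0 < η ^ 2 := by positivity
  have cp := (contDiff_prof (η ^ 2)).continuous
  have cΦ : Continuous Φ := by fun_prop
  have cb := continuous_bump
  have i2 : Integrable fun x => bump x * Φ x :=
    Continuous.integrable_of_hasCompactSupport (by fun_prop) hasCompactSupport_bump.mul_right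
  have i1 : Integrable fun x => bump ((η ^ 2)⁻¹ • x) * Φ x :=
    Continuous.integrable_of_hasCompactSupport (by fun_prop)
      (hasCompactSupport_bump.comp_smul (inv_ne_zero hη.ne')).mul_right
  have e : inter α β (η ^ 2) (η • p) =
      ∫ x, (((η ^ 2) ^ 2)⁻¹ * (bump ((η ^ 2)⁻¹ • x) * Φ x) - bump x * Φ x) := by
    refine integral_congr_ae (.of_forall fun x => ?_)
    simp only [rlap_pot hη]
    ring
  rw [e, integral_sub (i1.const_mul _) i2, integral_const_mul]
  congr 1
  have hcv := Measure.integral_comp_inv_smul_of_nonneg (volume : Measure E2)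
    (fun y => bump y * Φ ((η ^ 2) • y)) hη.le
  simp only [smul_inv_smul₀ hη.ne', finrank_euclideanSpace_fin, smul_eq_mul] at hcv
  rw [hcv, inv_mul_cancel_left₀ (by positivity)]
  refine integral_congr_ae (.of_forall fun y => ?_)
  have z1 : (η ^ 2) • y + η • p = η • (η • y + p) := by
    rw [smul_add, smul_smul, sq]
  have z2 : (2 : ℝ) • (η ^ 2) • y + η • p = η • ((2 * η) • y + p) := by
    rw [smul_add, smul_smul, smul_smul]; congr 2; ring
  simp only [hΦ, z1, z2, tform_smul_left, tform_smul_right, norm_smul, mul_pow,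
    Real.norm_eq_abs, sq_abs]
  ring

/-! ### Limits as the scale tends to zero -/

lemma tendsto_inter_near (α β : ℝ) {p : E2} (hp : p ≠ 0) :
    Filter.Tendsto (fun η : ℝ => ∫ y, bump y * (tform α β ((2 * η) • y + p) (η • y + p) *
        (η ^ 2 * prof (η ^ 2) (η ^ 2 * ‖η • y + p‖ ^ 2))))
      (nhdsWithin 0 (Set.Ioi 0)) (nhds (2 * π * kernelForm α β p)) := by
  rw [← integral_bump, ← integral_mul_const]
  have hp0 : 0 < ‖p‖ := norm_pos_iff.2 hp
  set M : ℝ := 2 * (|α| + |β|) with hM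
  have hM0 : 0 ≤ M := by positivity
  refine tendsto_integral_filter_of_dominated_convergence
    (fun y => bump y * (M * (2 + ‖p‖) * (2 / ‖p‖))) ?_ ?_ (integrable_bump.mul_const _) ?_
  · refine .of_forall fun η => Continuous.aestronglyMeasurable ?_
    have := (contDiff_prof (η ^ 2)).continuous
    have := continuous_bump
    fun_prop
  · have h1 : ∀ᶠ η : ℝ in nhdsWithin 0 (Set.Ioi 0), η < min 1 (‖p‖ / 2) :=
      mem_nhdsWithin_of_mem_nhds (Iio_mem_nhds (by positivity))
    filter_upwards [h1, self_mem_nhdsWithin] with η hη hη0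
    have hη0 : 0 < η := hη0
    obtain ⟨hη1, hη2⟩ := lt_min_iff.1 hη
    refine .of_forall fun y => ?_
    rw [norm_mul, Real.norm_of_nonneg (bump_nonneg y)]
    rcases lt_or_ge 1 ‖y‖ with hy | hy
    · simp [bump_of_one_lt_norm hy]
    refine mul_le_mul_of_nonneg_left ?_ (bump_nonneg y)
    have hηy : ‖η • y‖ ≤ ‖p‖ / 2 := by
      rw [norm_smul, Real.norm_of_nonneg hη0.le]
      nlinarith [norm_nonneg y]
    have hz : ‖p‖ / 2 ≤ ‖η • y + p‖ := by
      have := norm_sub_le (η • y + p) (η • y)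
      rw [add_sub_cancel_left] at this
      linarith
    have hz0 : 0 < ‖η • y + p‖ := by linarith
    have hw : ‖(2 * η) • y + p‖ ≤ 2 + ‖p‖ := by
      refine (norm_add_le _ _).trans ?_
      rw [norm_smul, Real.norm_of_nonneg (by positivity)]
      nlinarith [norm_nonneg y]
    have hprof : |η ^ 2 * prof (η ^ 2) (η ^ 2 * ‖η • y + p‖ ^ 2)| ≤ 1 / ‖η • y + p‖ ^ 2 := by
      rw [abs_mul, abs_of_nonneg (by positivity : 0 ≤ η ^ 2)]
      calc _ ≤ η ^ 2 * (1 / (η ^ 2 * ‖η • y + p‖ ^ 2)) := by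
            gcongr
            exact abs_prof_le (by positivity) (by positivity)
        _ = _ := by field_simp
    rw [Real.norm_eq_abs, abs_mul]
    calc _ ≤ (M * (‖(2 * η) • y + p‖ * ‖η • y + p‖)) * (1 / ‖η • y + p‖ ^ 2) := by
          gcongr
          exact abs_tform_le _ _ _ _
      _ = M * ‖(2 * η) • y + p‖ * (1 / ‖η • y + p‖) := by field_simp
      _ ≤ M * (2 + ‖p‖) * (1 / (‖p‖ / 2)) := by gcongr
      _ = _ := by rw [one_div_div]
  · refine .of_forall fun y => Filter.Tendsto.const_mul _ ?_
    have c1 : Filter.Tendsto (fun η : ℝ => tform α β ((2 * η) • y + p) (η • y + p) /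
        ‖η • y + p‖ ^ 2) (nhds 0) (nhds (kernelForm α β p)) := by
      have : ContinuousAt (fun η : ℝ => tform α β ((2 * η) • y + p) (η • y + p) /
        ‖η • y + p‖ ^ 2) 0 :=
        ContinuousAt.div (Continuous.continuousAt (by fun_prop))
          (Continuous.continuousAt (by fun_prop)) (by simpa using hp)
      simpa [ContinuousAt, kernelForm] using this
    refine (c1.mono_left nhdsWithin_le_nhds).congr' ?_
    have hc : Continuous fun η : ℝ => ‖η • y + p‖ := by fun_prop
    have h1 : ∀ᶠ η : ℝ in nhdsWithin 0 (Set.Ioi 0), η < ‖η • y + p‖ := by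
      refine mem_nhdsWithin_of_mem_nhds (continuous_id.continuousAt.eventually_lt
        hc.continuousAt ?_)
      simpa using hp
    have h2 : ∀ᶠ η : ℝ in nhdsWithin 0 (Set.Ioi 0), η ^ 2 * ‖η • y + p‖ ^ 2 < 1 / 2 := by
      refine mem_nhdsWithin_of_mem_nhds (Continuous.continuousAt (by fun_prop) |>.eventually_lt
        continuousAt_const ?_)
      simp
    filter_upwards [h1, h2, self_mem_nhdsWithin] with η hη1 hη2 hη0
    have hη0 : 0 < η := hη0
    have hz0 : 0 < ‖η • y + p‖ := hη0.trans hη1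
    rw [prof_eq (by positivity), step_of_le hη2.le]
    · field_simp
      ring
    · rw [sq (η ^ 2)]
      gcongr

lemma tendsto_inter_far (α β : ℝ) (p : E2) :
    Filter.Tendsto (fun η : ℝ => ∫ x, bump x *
        (tform α β ((2 : ℝ) • x + η • p) (x + η • p) * prof (η ^ 2) (‖x + η • p‖ ^ 2)))
      (nhdsWithin 0 (Set.Ioi 0)) (nhds 0) := by
  have hzero := integral_radial_mul_tform (fun r => (2 * deriv step (r ^ 2)) * (2 *
    ((1 - step (r ^ 2)) / r ^ 2))) α β
  refine Eq.mp (congrArg (fun z => Filter.Tendsto _ _ (nhds z)) hzero) ?_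
  set M : ℝ := 2 * (|α| + |β|) with hM
  have hM0 : 0 ≤ M := by positivity
  have hsmall : ∀ᶠ η : ℝ in nhdsWithin 0 (Set.Ioi 0), ‖η • p‖ < 1 / 4 := by
    refine mem_nhdsWithin_of_mem_nhds (Continuous.continuousAt (by fun_prop) |>.eventually_lt
      continuousAt_const ?_)
    simp
  refine tendsto_integral_filter_of_dominated_convergence
    (fun y => bump y * (M * 3 * 4)) ?_ ?_ (integrable_bump.mul_const _) ?_
  · refine .of_forall fun η => Continuous.aestronglyMeasurable ?_
    have := (contDiff_prof (η ^ 2)).continuous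
    have := continuous_bump
    fun_prop
  · filter_upwards [hsmall, self_mem_nhdsWithin] with η hη hη0
    have hη0 : 0 < η := hη0
    refine .of_forall fun x => ?_
    rw [norm_mul, Real.norm_of_nonneg (bump_nonneg x)]
    rcases lt_or_ge 1 ‖x‖ with hx | hx
    · simp [bump_of_one_lt_norm hx]
    rcases lt_or_ge ‖x‖ (1 / 2) with hx' | hx'
    · simp [bump_of_norm_lt hx']
    refine mul_le_mul_of_nonneg_left ?_ (bump_nonneg x)
    have hz : 1 / 4 ≤ ‖x + η • p‖ := by
      have := norm_sub_le (x + η • p) (η • p)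
      rw [add_sub_cancel_right] at this
      linarith
    have hz0 : 0 < ‖x + η • p‖ := by linarith
    have hw : ‖(2 : ℝ) • x + η • p‖ ≤ 3 := by
      refine (norm_add_le _ _).trans ?_
      rw [norm_smul, Real.norm_of_nonneg zero_le_two]
      linarith
    rw [Real.norm_eq_abs, abs_mul]
    calc _ ≤ (M * (‖(2 : ℝ) • x + η • p‖ * ‖x + η • p‖)) * (1 / ‖x + η • p‖ ^ 2) := by
          gcongr
          · exact abs_tform_le _ _ _ _
          · exact abs_prof_le (by positivity) (by positivity)
      _ = M * ‖(2 : ℝ) • x + η • p‖ * (1 / ‖x + η • p‖) := by field_simp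
      _ ≤ M * 3 * (1 / (1 / 4)) := by gcongr
      _ = _ := by norm_num
  · refine .of_forall fun x => ?_
    rcases eq_or_ne x 0 with rfl | hx
    · simp [bump_of_norm_lt, tform]
    have c1 : Filter.Tendsto (fun η : ℝ => bump x * (tform α β ((2 : ℝ) • x + η • p) (x + η • p) *
        ((1 - step (‖x + η • p‖ ^ 2)) / ‖x + η • p‖ ^ 2))) (nhds 0)
        (nhds (2 * deriv step (‖x‖ ^ 2) * (2 * ((1 - step (‖x‖ ^ 2)) / ‖x‖ ^ 2)) *
          tform α β x x)) := by
      have cs := contDiff_step.continuous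
      have : ContinuousAt (fun η : ℝ => bump x * (tform α β ((2 : ℝ) • x + η • p) (x + η • p) *
        ((1 - step (‖x + η • p‖ ^ 2)) / ‖x + η • p‖ ^ 2))) 0 := by
        refine continuousAt_const.mul (ContinuousAt.mul (Continuous.continuousAt (by fun_prop))
          (ContinuousAt.div (Continuous.continuousAt (by fun_prop))
          (Continuous.continuousAt (by fun_prop)) (by simpa using hx)))
      rw [ContinuousAt] at this
      convert this using 2
      simp only [zero_smul, add_zero, bump, tform_smul_left]
      ring
    refine (c1.mono_left nhdsWithin_le_nhds).congr' ?_
    have h1 : ∀ᶠ η : ℝ in nhdsWithin 0 (Set.Ioi 0), (η ^ 2) ^ 2 < ‖x + η • p‖ ^ 2 := by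
      refine mem_nhdsWithin_of_mem_nhds (Continuous.continuousAt (by fun_prop) |>.eventually_lt
        (Continuous.continuousAt (by fun_prop)) ?_)
      simpa using pow_pos (norm_pos_iff.2 hx) 2
    filter_upwards [h1, self_mem_nhdsWithin] with η hη1 hη0
    have hη0 : 0 < η := hη0
    rw [prof_eq (by positivity) hη1.le]

lemma tendsto_inter (α β : ℝ) (p : E2) :
    Filter.Tendsto (fun η : ℝ => inter α β (η ^ 2) (η • p)) (nhdsWithin 0 (Set.Ioi 0))
      (nhds (2 * π * kernelForm α β p)) := by
  rcases eq_or_ne p 0 with rfl | hp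
  · refine (tendsto_const_nhds (x := (0 : ℝ))).congr' ?_ |>.trans (by simp [kernelForm])
    filter_upwards [self_mem_nhdsWithin] with η hη
    rw [smul_zero, inter_zero α β (pow_pos hη 2)]
  · have h := (tendsto_inter_near α β hp).sub (tendsto_inter_far α β p)
    rw [sub_zero] at h
    refine h.congr' ?_
    filter_upwards [self_mem_nhdsWithin] with η hη
    exact (inter_eq α β hη p).symm

/-! ### Superpositions of potentials -/

/-- The superposition of the potentials `pot (η ^ 2)` centred at `η • p k`, with weights `c k`. -/
def superpos {ι : Type*} [Fintype ι] (c : ι → ℝ) (p : ι → E2) (η : ℝ) (x : E2) : ℝ :=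
  ∑ k, c k * pot (η ^ 2) (x - η • p k)

section Superposition

variable {ι : Type*} [Fintype ι] (c : ι → ℝ) (p : ι → E2)

lemma contDiff_superpos (η : ℝ) : ContDiff ℝ (⊤ : ℕ∞) (superpos c p η) :=
  ContDiff.sum fun _ _ => contDiff_const.mul
    ((contDiff_pot (η ^ 2)).comp (contDiff_id.sub contDiff_const))

lemma hasCompactSupport_superpos {η : ℝ} (h0 : 0 < η) (h1 : η ≤ 1) :
    HasCompactSupport (superpos c p η) := by
  have hs (k : ι) : HasCompactSupport fun x : E2 => c k * pot (η ^ 2) (x - η • p k) :=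
    ((hasCompactSupport_pot (pow_pos h0 2) (pow_le_one₀ h0.le h1)).comp_homeomorph
      (Homeomorph.subRight (η • p k))).mul_left
  have hu : HasCompactSupport (∑ k, fun x : E2 => c k * pot (η ^ 2) (x - η • p k)) :=
    Finset.sum_induction _ HasCompactSupport (fun _ _ => HasCompactSupport.add)
      HasCompactSupport.zero fun k _ => hs k
  convert hu using 1
  ext x
  simp [superpos]

lemma rpd_sum_mul_comp_sub (f : E2 → ℝ) (hf : ContDiff ℝ (⊤ : ℕ∞) f) (i : Fin 2) (x : E2) :
    rpd i (fun y => ∑ k, c k * f (y - p k)) x = ∑ k, c k * rpd i f (x - p k) := by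
  have hd (k : ι) : DifferentiableAt ℝ (fun y => f (y - p k)) x :=
    (hf.comp (contDiff_id.sub contDiff_const)).differentiable (by simp) x
  rw [rpd_sum _ _ fun k _ => (hd k).const_mul (c k)]
  simp only [rpd_mul i (differentiableAt_const _) (hd _), rpd_const, rpd_comp_sub, zero_mul,
    zero_add]

lemma rpd_superpos (η : ℝ) (i : Fin 2) (x : E2) :
    rpd i (superpos c p η) x = ∑ k, c k * rpd i (pot (η ^ 2)) (x - η • p k) :=
  rpd_sum_mul_comp_sub c (fun k => η • p k) _ (contDiff_pot _) i x

lemma rlap_superpos (η : ℝ) (x : E2) :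
    rlap (superpos c p η) x = ∑ k, c k * rlap (pot (η ^ 2)) (x - η • p k) := by
  have h (i : Fin 2) : rpd i (rpd i (superpos c p η)) x =
      ∑ k, c k * rpd i (rpd i (pot (η ^ 2))) (x - η • p k) := by
    rw [show rpd i (superpos c p η) = _ from funext (rpd_superpos c p η i)]
    exact rpd_sum_mul_comp_sub c (fun k => η • p k) _ (contDiff_rpd (contDiff_pot _) i) i x
  simp only [rlap, h, mul_add, Finset.sum_add_distrib]

lemma tform_grad_superpos (α β η : ℝ) (x : E2) :
    tform α β (grad (superpos c p η) x) (grad (superpos c p η) x) =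
      ∑ j, ∑ k, c j * c k * tform α β (grad (pot (η ^ 2)) (x - η • p j))
        (grad (pot (η ^ 2)) (x - η • p k)) := by
  simp only [tform, grad_apply_zero, grad_apply_one, rpd_superpos, Finset.sum_mul_sum]
  simp only [← Finset.sum_sub_distrib, ← Finset.sum_add_distrib, Finset.mul_sum]
  refine Finset.sum_congr rfl fun j _ => Finset.sum_congr rfl fun k _ => ?_
  ring

lemma hasCompactSupport_grad {u : E2 → ℝ} (hu : HasCompactSupport u) :
    HasCompactSupport (grad u) :=
  (hasCompactSupport_rpd hu 0).comp₂_left (m := fun a b : ℝ => (!₂[a, b] : E2))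
    (hasCompactSupport_rpd hu 1) (by ext i; fin_cases i <;> simp)

lemma integral_tform_grad_superpos (α β : ℝ) {η : ℝ} (h0 : 0 < η) (h1 : η ≤ 1) :
    ∫ x, tform α β (grad (superpos c p η) x) (grad (superpos c p η) x) =
      -(∑ j, ∑ k, c j * c k * (inter α β (η ^ 2) (η • (p k - p j)) / 2)) := by
  have hδ0 : 0 < η ^ 2 := pow_pos h0 2
  have hδ1 : η ^ 2 ≤ 1 := pow_le_one₀ h0.le h1
  have hg := continuous_grad_pot (η ^ 2)
  have hi (j k : ι) : Integrable fun x : E2 => c j * c k *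
      tform α β (grad (pot (η ^ 2)) (x - η • p j)) (grad (pot (η ^ 2)) (x - η • p k)) := by
    refine (Continuous.integrable_of_hasCompactSupport (by fun_prop) ?_).const_mul _
    have hs (q : E2) : HasCompactSupport fun x => grad (pot (η ^ 2)) (x - q) :=
      (hasCompactSupport_grad (hasCompactSupport_pot hδ0 hδ1)).comp_homeomorph
        (Homeomorph.subRight q)
    exact (hs _).comp₂_left (m := tform α β) (hs _) (by simp [tform])
  simp only [tform_grad_superpos]
  rw [integral_finsetSum _ fun j _ => integrable_finsetSum _ fun k _ => hi j k,
    ← Finset.sum_neg_distrib]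
  refine Finset.sum_congr rfl fun j _ => ?_
  rw [integral_finsetSum _ fun k _ => hi j k, ← Finset.sum_neg_distrib]
  refine Finset.sum_congr rfl fun k _ => ?_
  have h := integral_tform_grad_pot α β hδ0 hδ1 (η • p j) (η • p k)
  rw [integral_const_mul, smul_sub]
  linear_combination (c j * c k / 2) * h

lemma integral_scaled_bump {δ : ℝ} (h0 : 0 < δ) (q : E2) :
    ∫ x, (δ ^ 2)⁻¹ * bump (δ⁻¹ • (x - q)) = 2 * π := by
  rw [integral_sub_right_eq_self (fun x : E2 => (δ ^ 2)⁻¹ * bump (δ⁻¹ • x)) q,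
    integral_const_mul, Measure.integral_comp_inv_smul_of_nonneg _ _ h0.le, integral_bump]
  simp [h0.ne']

lemma integrable_scaled_bump {δ : ℝ} (h0 : 0 < δ) (q : E2) :
    Integrable fun x => (δ ^ 2)⁻¹ * bump (δ⁻¹ • (x - q)) :=
  ((integrable_bump.comp_smul (inv_ne_zero h0.ne')).comp_sub_right q).const_mul _

lemma integral_abs_rlap_superpos_le {η : ℝ} (h0 : 0 < η) :
    ∫ x, |rlap (superpos c p η) x| ≤
      2 * π * ∑ k, |c k| + ∫ x, |∑ k, c k * bump (x - η • p k)| := by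
  have hδ0 : 0 < η ^ 2 := pow_pos h0 2
  have hi1 (k : ι) : Integrable fun x : E2 =>
      |c k| * (((η ^ 2) ^ 2)⁻¹ * bump ((η ^ 2)⁻¹ • (x - η • p k))) :=
    (integrable_scaled_bump hδ0 _).const_mul _
  have hi2 : Integrable fun x : E2 => |∑ k, c k * bump (x - η • p k)| :=
    (integrable_finsetSum _ fun k _ => (integrable_bump.comp_sub_right (η • p k)).const_mul _).abs
  have hsum : 2 * π * ∑ k, |c k| = ∫ x : E2, ∑ k,
      |c k| * (((η ^ 2) ^ 2)⁻¹ * bump ((η ^ 2)⁻¹ • (x - η • p k))) := by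
    rw [integral_finsetSum _ fun k _ => hi1 k, Finset.mul_sum]
    refine Finset.sum_congr rfl fun k _ => ?_
    rw [integral_const_mul, integral_scaled_bump hδ0, mul_comm]
  rw [hsum, ← integral_add (integrable_finsetSum _ fun k _ => hi1 k) hi2]
  refine integral_mono_of_nonneg (.of_forall fun x => abs_nonneg _)
    ((integrable_finsetSum _ fun k _ => hi1 k).add hi2) (.of_forall fun x => ?_)
  simp only [rlap_superpos, rlap_pot hδ0, mul_sub, Finset.sum_sub_distrib]
  refine (abs_sub _ _).trans (add_le_add_left ((Finset.abs_sum_le_sum_abs _ _).trans_eq ?_) _)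
  refine Finset.sum_congr rfl fun k _ => ?_
  rw [abs_mul, abs_of_nonneg (mul_nonneg (by positivity) (bump_nonneg _))]

lemma tendsto_integral_abs_sum_bump (hc : ∑ k, c k = 0) :
    Filter.Tendsto (fun η : ℝ => ∫ x, |∑ k, c k * bump (x - η • p k)|)
      (nhdsWithin 0 (Set.Ioi 0)) (nhds 0) := by
  have hb := continuous_bump
  have hcont₂ : Continuous fun q : ℝ × E2 => |∑ k, c k * bump (q.2 - q.1 • p k)| := by fun_prop
  have hcont : ContinuousOn (fun η : ℝ => ∫ x, |∑ k, c k * bump (x - η • p k)|)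
      (Set.Ioo (-1) 1) := by
    refine continuousOn_integral_of_compact_support
      (isCompact_closedBall (0 : E2) (1 + ∑ k, ‖p k‖))
      hcont₂.continuousOn fun η x hη hx => ?_
    rw [abs_eq_zero]
    refine Finset.sum_eq_zero fun k _ => ?_
    rw [bump_of_one_lt_norm, mul_zero]
    rw [mem_closedBall_zero_iff, not_le] at hx
    have h1 : ‖η • p k‖ ≤ ‖p k‖ := by
      rw [norm_smul]
      exact mul_le_of_le_one_left (norm_nonneg _) (abs_le.2 ⟨hη.1.le, hη.2.le⟩)
    have h2 : ‖p k‖ ≤ ∑ k, ‖p k‖ :=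
      Finset.single_le_sum (f := fun k => ‖p k‖) (fun _ _ => norm_nonneg _) (Finset.mem_univ k)
    have h3 := norm_sub_norm_le x (η • p k)
    linarith
  have h := (hcont.continuousAt (Ioo_mem_nhds (by norm_num) one_pos)).tendsto
  simp only [zero_smul, sub_zero, ← Finset.sum_mul, hc, zero_mul, abs_zero, integral_zero] at h
  exact h.mono_left nhdsWithin_le_nhds

/-- An `L¹` bound for the gradient form yields an inequality for finite systems of neutral
charges interacting through the kernel `kernelForm`. -/
lemma sum_kernelForm_le {α β C : ℝ} (hC : 0 ≤ C)
    (h : ∀ u : E2 → ℝ, ContDiff ℝ (⊤ : ℕ∞) u → HasCompactSupport u →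
      -∫ x, tform α β (grad u x) (grad u x) ≤ C * (∫ x, |rlap u x|) ^ 2)
    (hc : ∑ k, c k = 0) :
    π * ∑ j, ∑ k, c j * c k * kernelForm α β (p k - p j) ≤ C * (2 * π * ∑ k, |c k|) ^ 2 := by
  have hleft : Filter.Tendsto
      (fun η : ℝ => ∑ j, ∑ k, c j * c k * (inter α β (η ^ 2) (η • (p k - p j)) / 2))
      (nhdsWithin 0 (Set.Ioi 0))
      (nhds (∑ j, ∑ k, c j * c k * (2 * π * kernelForm α β (p k - p j) / 2))) :=
    tendsto_finsetSum _ fun j _ => tendsto_finsetSum _ fun k _ =>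
      ((tendsto_inter α β (p k - p j)).div_const 2).const_mul _
  have hright := (((tendsto_integral_abs_sum_bump c p hc).const_add
    (2 * π * ∑ k, |c k|)).pow 2).const_mul C
  rw [add_zero] at hright
  have hle := le_of_tendsto_of_tendsto hleft hright ?_
  · refine le_trans (le_of_eq ?_) hle
    simp only [Finset.mul_sum]
    refine Finset.sum_congr rfl fun j _ => Finset.sum_congr rfl fun k _ => ?_
    ring
  filter_upwards [Ioo_mem_nhdsGT (one_pos (α := ℝ))] with η hη
  have hu := h _ (contDiff_superpos c p η) (hasCompactSupport_superpos c p hη.1 hη.2.le)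
  rw [integral_tform_grad_superpos c p α β hη.1 hη.2.le, neg_neg] at hu
  refine hu.trans (mul_le_mul_of_nonneg_left (pow_le_pow_left₀ ?_ ?_ 2) hC)
  · exact integral_nonneg fun x => abs_nonneg _
  · exact integral_abs_rlap_superpos_le c p hη.1

end Superposition

/-! ### Configurations of charges on two parallel rows -/

lemma kernelForm_smul (α β : ℝ) {s : ℝ} (hs : s ≠ 0) (p : E2) :
    kernelForm α β (s • p) = kernelForm α β p := by
  have : s ^ 2 ≠ 0 := pow_ne_zero 2 hs
  simp only [kernelForm, tform_smul_left, tform_smul_right, norm_smul, mul_pow, Real.norm_eq_abs,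
    sq_abs, ← mul_assoc, ← sq]
  exact mul_div_mul_left _ _ this

lemma tendsto_kernelForm_add_smul (α β : ℝ) (v : E2) {w : E2} (hw : w ≠ 0) :
    Filter.Tendsto (fun L : ℝ => kernelForm α β (v + L • w)) Filter.atTop
      (nhds (kernelForm α β w)) := by
  have hcont : ContinuousAt (fun s : ℝ => kernelForm α β (s • v + w)) 0 := by
    unfold kernelForm
    exact ContinuousAt.div (Continuous.continuousAt (by fun_prop))
      (Continuous.continuousAt (by fun_prop)) (by simpa using hw)
  have h := hcont.tendsto.comp tendsto_inv_atTop_zero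
  simp only [zero_smul, zero_add] at h
  refine h.congr' ?_
  filter_upwards [Filter.eventually_gt_atTop 0] with L hL
  rw [Function.comp_apply, ← kernelForm_smul α β hL.ne', smul_add, smul_inv_smul₀ hL.ne']

lemma tform_le_of_integral_le {α β C : ℝ} (hC : 0 ≤ C)
    (h : ∀ u : E2 → ℝ, ContDiff ℝ (⊤ : ℕ∞) u → HasCompactSupport u →
      -∫ x, tform α β (grad u x) (grad u x) ≤ C * (∫ x, |rlap u x|) ^ 2)
    {w : E2} (hw : ‖w‖ = 1) : tform α β w w ≤ 4 * π * C := by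
  have hw0 : w ≠ 0 := by rintro rfl; simp at hw
  have hr : kernelForm α β (rot w) = -tform α β w w := by
    simp [kernelForm, tform_rot_rot, hw]
  have hr' : kernelForm α β (-rot w) = -tform α β w w := by
    simp [kernelForm, tform_neg_neg, tform_rot_rot, hw]
  have hrot : rot w ≠ 0 := by simpa using hw0
  have key (N : ℕ) : (4 * (N : ℝ) ^ 2 - 2 * N) * tform α β w w ≤ 16 * π * C * N ^ 2 := by
    have hfin (L : ℝ) := sum_kernelForm_le (α := α) (β := β)
      (fun k : Fin N × Bool => if k.2 then (1 : ℝ) else -1)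
      (fun k : Fin N × Bool => (k.1 : ℝ) • w + if k.2 then 0 else L • rot w) hC h
      (by simp [Fintype.sum_prod_type])
    have hlim : Filter.Tendsto (fun L : ℝ => π * ∑ j : Fin N, ∑ k : Fin N,
        (2 * kernelForm α β (((k : ℝ) - j) • w)
          - kernelForm α β (((k : ℝ) - j) • w + L • rot w)
          - kernelForm α β (((k : ℝ) - j) • w + L • (-rot w)))) Filter.atTop
        (nhds (π * ∑ j : Fin N, ∑ k : Fin N,
          (2 * kernelForm α β (((k : ℝ) - j) • w) - (-tform α β w w) - (-tform α β w w)))) := by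
      refine Filter.Tendsto.const_mul _ (tendsto_finsetSum _ fun j _ =>
        tendsto_finsetSum _ fun k _ => (tendsto_const_nhds.sub ?_).sub ?_)
      · rw [← hr]; exact tendsto_kernelForm_add_smul α β _ hrot
      · rw [← hr']; exact tendsto_kernelForm_add_smul α β _ (neg_ne_zero.2 hrot)
    have hle := le_of_tendsto hlim (b := C * (2 * π * (2 * N)) ^ 2) (.of_forall fun L => ?_)
    · have hdiag (j k : Fin N) : 2 * kernelForm α β (((k : ℝ) - j) • w) - (-tform α β w w) -
          (-tform α β w w) = 4 * tform α β w w - if j = k then 2 * tform α β w w else 0 := by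
        split_ifs with hjk
        · simp [hjk, kernelForm, tform]; ring
        · have : ((k : ℝ) - j) ≠ 0 := by
            rw [sub_ne_zero]
            exact_mod_cast fun hkj => hjk (Fin.ext hkj).symm
          rw [kernelForm_smul α β this, kernelForm, hw]
          ring
      simp only [hdiag, Finset.sum_sub_distrib, Finset.sum_ite_eq, Finset.mem_univ, if_true,
        Finset.sum_const, Finset.card_univ, Fintype.card_fin, nsmul_eq_mul] at hle
      refine le_of_mul_le_mul_left ?_ Real.pi_pos
      linarith
    · refine le_trans (le_of_eq ?_) ((hfin L).trans_eq ?_)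
      · congr 1
        simp only [Fintype.sum_prod_type, Fintype.sum_bool, if_true, ← Finset.sum_add_distrib]
        refine Finset.sum_congr rfl fun j _ => Finset.sum_congr rfl fun k _ => ?_
        have e1 : (k : ℝ) • w + 0 - ((j : ℝ) • w + 0) = ((k : ℝ) - j) • w := by module
        have e2 : (k : ℝ) • w + L • rot w - ((j : ℝ) • w + 0) =
          ((k : ℝ) - j) • w + L • rot w := by module
        have e3 : (k : ℝ) • w + 0 - ((j : ℝ) • w + L • rot w) =
          ((k : ℝ) - j) • w + L • (-rot w) := by module
        have e4 : (k : ℝ) • w + L • rot w - ((j : ℝ) • w + L • rot w) =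
          ((k : ℝ) - j) • w := by module
        simp only [Bool.false_eq_true, if_false, e1, e2, e3, e4]
        ring
      · have habs : ∑ k : Fin N × Bool, |if k.2 then (1 : ℝ) else -1| = 2 * N := by
          simp [Fintype.sum_prod_type]
          ring
        rw [habs]
  by_contra! hlt
  obtain ⟨N, hN⟩ := exists_nat_gt (|tform α β w w| / (tform α β w w - 4 * π * C))
  rw [div_lt_iff₀ (by linarith)] at hN
  have hN0 : (0 : ℝ) < N := by
    by_contra! hN0
    nlinarith [abs_nonneg (tform α β w w)]
  have := key N
  have h2 := le_abs_self (tform α β w w)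
  nlinarith [mul_pos hN0 hN0, mul_lt_mul_of_pos_left hN hN0]

/-! ### Reduction to real functions -/

lemma pd_ofReal {u : E2 → ℝ} (hu : ContDiff ℝ (⊤ : ℕ∞) u) (i : Fin 2) (x : E2) :
    pd i (fun y => (u y : ℂ)) x = (rpd i u x : ℂ) := by
  have h := Complex.ofRealCLM.hasFDerivAt.comp x
    ((hu.differentiable (by simp)) x).hasFDerivAt
  have h' : HasFDerivAt (fun y => (u y : ℂ)) _ x := h
  simp [pd, rpd, h'.fderiv]

lemma lap_ofReal {u : E2 → ℝ} (hu : ContDiff ℝ (⊤ : ℕ∞) u) (x : E2) :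
    lap (fun y => (u y : ℂ)) x = (rlap u x : ℂ) := by
  have h (i : Fin 2) : pd i (fun y => (u y : ℂ)) = fun y => (rpd i u y : ℂ) :=
    funext (pd_ofReal hu i)
  simp only [lap, rlap, h, pd_ofReal (contDiff_rpd hu _), Complex.ofReal_add]

lemma sum_form_ofReal (A : Matrix (Fin 2) (Fin 2) ℂ) (htr : A 0 0 + A 1 1 = 0) (ζ : ℂ) (v : E2) :
    (ζ * ∑ i : Fin 2, ∑ j : Fin 2, A i j * (v i : ℂ) * (v j : ℂ)).re =
      tform (ζ * A 0 0).re (ζ * (A 0 1 + A 1 0) / 2).re v v := by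
  have h11 : A 1 1 = -A 0 0 := by linear_combination htr
  simp [Fin.sum_univ_two, h11, tform, Complex.mul_re, Complex.mul_im]
  ring

lemma norm_form_le (A : Matrix (Fin 2) (Fin 2) ℂ) (htr : A 0 0 + A 1 1 = 0)
    (C : ℝ) (hC : 0 ≤ C)
    (h : ∀ u : E2 → ℂ, ContDiff ℝ (⊤ : ℕ∞) u → HasCompactSupport u →
      ‖∫ x : E2, ∑ i : Fin 2, ∑ j : Fin 2,
          A i j * pd i u x * (starRingEnd ℂ) (pd j u x)‖ ≤
        C * (∫ x : E2, ‖lap u x‖) ^ 2) {w : E2} (hw : ‖w‖ = 1) :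
    ‖∑ i : Fin 2, ∑ j : Fin 2, A i j * (w i : ℂ) * (w j : ℂ)‖ ≤ 4 * π * C := by
  set z := ∑ i : Fin 2, ∑ j : Fin 2, A i j * (w i : ℂ) * (w j : ℂ) with hz
  obtain ⟨ζ, hζ, hζz⟩ : ∃ ζ : ℂ, ‖ζ‖ = 1 ∧ (‖z‖ : ℂ) = ζ * z := by
    obtain ⟨ζ, hζ⟩ := RCLike.exists_norm_eq_mul_self z
    exact ⟨ζ, hζ⟩
  rw [← Complex.ofReal_re ‖z‖, hζz, hz, sum_form_ofReal A htr]
  refine tform_le_of_integral_le hC (fun u hu hs => ?_) hw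
  have hU : ContDiff ℝ (⊤ : ℕ∞) fun x => (u x : ℂ) := Complex.ofRealCLM.contDiff.comp hu
  have hS : HasCompactSupport fun x => (u x : ℂ) := hs.comp_left Complex.ofReal_zero
  have hle := h _ hU hS
  simp only [pd_ofReal hu, lap_ofReal hu, Complex.conj_ofReal, Complex.norm_real,
    Real.norm_eq_abs] at hle
  refine le_trans ?_ hle
  have hi : Integrable fun x : E2 => ∑ i : Fin 2, ∑ j : Fin 2,
      A i j * (rpd i u x : ℂ) * (rpd j u x : ℂ) := by
    have hr (i j : Fin 2) : Integrable fun x : E2 => rpd i u x * rpd j u x :=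
      Continuous.integrable_of_hasCompactSupport
        ((contDiff_rpd hu i).continuous.mul (contDiff_rpd hu j).continuous)
        (hasCompactSupport_rpd hs i).mul_right
    refine integrable_finsetSum _ fun i _ => integrable_finsetSum _ fun j _ => ?_
    refine ((hr i j).ofReal (𝕜 := ℂ) |>.const_mul (A i j)).congr (.of_forall fun x => ?_)
    simp [mul_assoc]
  have hre : ∫ x, tform (ζ * A 0 0).re (ζ * (A 0 1 + A 1 0) / 2).re (grad u x) (grad u x) =
      (ζ * ∫ x : E2, ∑ i : Fin 2, ∑ j : Fin 2,
        A i j * (rpd i u x : ℂ) * (rpd j u x : ℂ)).re := by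
    rw [← integral_const_mul]
    refine Eq.trans (integral_congr_ae (.of_forall fun x => ?_))
      (Complex.reCLM.integral_comp_comm (hi.const_mul ζ))
    have hg (i : Fin 2) : grad u x i = rpd i u x := by fin_cases i <;> rfl
    simpa only [hg, Complex.reCLM_apply] using (sum_form_ofReal A htr ζ (grad u x)).symm
  rw [hre]
  refine (neg_le_abs _).trans ((Complex.abs_re_le_norm _).trans_eq ?_)
  rw [norm_mul, hζ, one_mul]

/-- Sharpness: any admissible constant `C` in the estimate of the quadratic form of the
gradient by `(∫ |Δu|)²` satisfies `C ≥ (1/(4π)) max_{ω ∈ S¹} |Σ a_{ij} ω_i ω_j|`. -/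
theorem best_constant_lower_bound
    (A : Matrix (Fin 2) (Fin 2) ℂ) (htr : A 0 0 + A 1 1 = 0)
    (C : ℝ) (hC : 0 ≤ C)
    (h : ∀ u : E2 → ℂ, ContDiff ℝ (⊤ : ℕ∞) u → HasCompactSupport u →
      ‖∫ x : E2, ∑ i : Fin 2, ∑ j : Fin 2,
          A i j * pd i u x * (starRingEnd ℂ) (pd j u x)‖ ≤
        C * (∫ x : E2, ‖lap u x‖) ^ 2) :
    (1 / (4 * π)) *
      (⨆ ω : Metric.sphere (0 : E2) 1,
        ‖∑ i : Fin 2, ∑ j : Fin 2, A i j * ((ω : E2) i : ℂ) * ((ω : E2) j : ℂ)‖) ≤ C := by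
  rw [one_div, inv_mul_le_iff₀ (by positivity)]
  have : Nonempty (Metric.sphere (0 : E2) 1) :=
    ⟨⟨EuclideanSpace.single 0 1, by simp⟩⟩
  exact ciSup_le fun ω => norm_form_le A htr C hC h (mem_sphere_zero_iff_norm.1 ω.2)
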